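/- arXiv:quant-ph/0606049 — 2 statements merged into one kernel-verified Lean document; each statement's English description precedes it below -/
import Mathlib

section
/- Let P(𝐚,𝐛|𝐱,𝐲) be any 2N-partite nonsignaling conditional distribution with outputs 𝐚,𝐛 ∈ {0,1}^N and inputs 𝐱,𝐲 ∈ {0,…,M−1}^N. Then for every 𝐚 ∈ {0,1}^N, Alice's marginal with all inputs zero satisfies P_{𝐀|𝐗}(𝐚|𝟎) = (β_{a_1} ⊗ β_{a_2} ⊗ ⋯ ⊗ β_{a_N}) · P, where P_{𝐀|𝐗}(𝐚|𝟎) = Σ_𝐛 P(𝐚,𝐛|𝟎,𝐲) (independent of 𝐲 by nonsignaling) and the dot product sums over all indices (𝐚',𝐛,𝐱,𝐲): (⊗_n β_{a_n})·P = Σ_{𝐚',𝐛,𝐱,𝐲} (Π_{n=1}^N β_{a_n}(a'_n,b_n,x_n,y_n)) P(𝐚',𝐛|𝐱,𝐲). -/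
open scoped Classical
open Finset

set_option linter.unusedVariables false

/-- The set `S` of input pairs: `y = x` or `y = x + 1 (mod M)`. -/
def Sprop {M : ℕ} [NeZero M] (x y : Fin M) : Prop := y = x ∨ y = x + 1

/-- The vector `μ`, indexed by tuples `(a,b,x,y)`. -/
noncomputable def μv (M : ℕ) [NeZero M] (a b : Fin 2) (x y : Fin M) : ℝ :=
  if Sprop x y then 1 / (4 * M) else 0

/-- The vector `ν`, indexed by tuples `(a,b,x,y)`. -/
noncomputable def νv (M : ℕ) [NeZero M] (a b : Fin 2) (x y : Fin M) : ℝ :=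
  if ((x : ℕ) = 0 ∧ (y : ℕ) = 0) ∨ ((y : ℕ) = (x : ℕ) + 1) then
    (1 / 4) * ((-1 : ℝ) ^ (a : ℕ) - (-1 : ℝ) ^ (b : ℕ))
  else if y = x ∧ 1 ≤ (x : ℕ) then
    -(1 / 4) * ((-1 : ℝ) ^ (a : ℕ) - (-1 : ℝ) ^ (b : ℕ))
  else if (x : ℕ) = M - 1 ∧ (y : ℕ) = 0 then
    (1 / 4) * ((-1 : ℝ) ^ (a : ℕ) + (-1 : ℝ) ^ (b : ℕ))
  else 0

/-- The vector `β_a = μ + (-1)^a ν`, evaluated at index tuple `(a',b,x,y)`. -/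
noncomputable def βa (M : ℕ) [NeZero M] (a : Fin 2) (a' b : Fin 2) (x y : Fin M) : ℝ :=
  μv M a' b x y + (-1 : ℝ) ^ (a : ℕ) * νv M a' b x y

theorem Fin.val_add_one_cases {M : ℕ} [NeZero M] (hM : 2 ≤ M) (x : Fin M) :
    (x + 1 ≠ 0 ∧ ((x + 1 : Fin M) : ℕ) = x + 1) ∨
      (x + 1 = 0 ∧ ((x + 1 : Fin M) : ℕ) = 0 ∧ (x : ℕ) = M - 1) := by
  obtain ⟨m, rfl⟩ : ∃ m, M = m + 2 := ⟨M - 2, by omega⟩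
  have hx := x.isLt
  have hv : ((x + 1 : Fin (m + 2)) : ℕ) = (x + 1) % (m + 2) := by
    rw [Fin.val_add]; simp
  simp only [Ne, Fin.ext_iff, hv, Fin.val_zero]
  rcases Nat.lt_or_ge ((x : ℕ) + 1) (m + 2) with h | h
  · rw [Nat.mod_eq_of_lt h]; omega
  · have h' : (x : ℕ) + 1 = m + 2 := by omega
    rw [h', Nat.mod_self]; omega

theorem Fin.ne_add_one_self {M : ℕ} [NeZero M] (hM : 2 ≤ M) (x : Fin M) : x ≠ x + 1 := by
  have := Fin.val_add_one_cases hM x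
  intro h
  have := congrArg Fin.val h
  omega

theorem νv_self (M : ℕ) [NeZero M] (a b : Fin 2) (x : Fin M) :
    νv M a b x x = (1 / 4) * (if x = 0 then 1 else -1) *
      ((-1 : ℝ) ^ (a : ℕ) - (-1 : ℝ) ^ (b : ℕ)) := by
  by_cases h : x = 0
  · subst h; simp [νv]
  · have h0 : (x : ℕ) ≠ 0 := fun h' => h (Fin.ext (by simpa using h'))
    have h1 : 1 ≤ (x : ℕ) := by omega
    simp [νv, h, h1]

theorem νv_succ {M : ℕ} [NeZero M] (hM : 2 ≤ M) (a b : Fin 2) (x : Fin M) :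
    νv M a b x (x + 1) = (1 / 4) * ((-1 : ℝ) ^ (a : ℕ) +
      (if x + 1 = 0 then 1 else -1) * (-1 : ℝ) ^ (b : ℕ)) := by
  have hne := (Fin.ne_add_one_self hM x).symm
  rcases Fin.val_add_one_cases hM x with ⟨h0, h1⟩ | ⟨h0, h1, h2⟩
  · rw [νv, if_pos (Or.inr h1), if_neg h0]; ring
  · rw [νv, if_neg (by omega), if_neg (fun h => hne h.1), if_pos ⟨h2, h1⟩, if_pos h0]; ring

theorem βa_eq_zero {M : ℕ} [NeZero M] (hM : 2 ≤ M) (a a' b : Fin 2) {x y : Fin M}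
    (h : y ≠ x) (h' : y ≠ x + 1) : βa M a a' b x y = 0 := by
  have hS : ¬ Sprop x y := by simp [Sprop, h, h']
  have hx : (y : ℕ) ≠ x := fun e => h (Fin.ext e)
  have hx' : (y : ℕ) ≠ (x + 1 : Fin M) := fun e => h' (Fin.ext e)
  have hlt := (x + 1).isLt
  have hν : νv M a' b x y = 0 := by
    rw [νv, if_neg, if_neg (fun e => h e.1), if_neg]
    all_goals
      rcases Fin.val_add_one_cases hM x with ⟨-, h1⟩ | ⟨-, h1, h2⟩ <;> omega
  simp [βa, μv, hS, hν]

theorem sum_mul_eq_diag_add_succ {M : ℕ} [NeZero M] (hM : 2 ≤ M) (x : Fin M) (w : Fin M → ℝ)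
    (hw : ∀ y, y ≠ x → y ≠ x + 1 → w y = 0) : ∑ y, w y = w x + w (x + 1) := by
  rw [← Finset.sum_pair (Fin.ne_add_one_self hM x)]
  refine (Finset.sum_subset (Finset.subset_univ _) fun y _ hy => ?_).symm
  simp only [Finset.mem_insert, Finset.mem_singleton, not_or] at hy
  exact hw y hy.1 hy.2

/-- The single-pair case: for an unnormalized bipartite nonsignaling array `Q`, contraction with
`β_a` yields Alice's marginal at input `0`. -/
theorem βa_contract_eq_marginal {M : ℕ} [NeZero M] (hM : 2 ≤ M)
    (Q : Fin 2 → Fin 2 → Fin M → Fin M → ℝ)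
    (hA : ∀ b x x' y, ∑ v, Q v b x y = ∑ v, Q v b x' y)
    (hB : ∀ a x y y', ∑ v, Q a v x y = ∑ v, Q a v x y') (a : Fin 2) (y₀ : Fin M) :
    ∑ a', ∑ b, ∑ x, ∑ y, βa M a a' b x y * Q a' b x y = ∑ b, Q a b 0 y₀ := by
  simp only [Fin.sum_univ_two] at hA hB
  set s : ℝ := (-1 : ℝ) ^ (a : ℕ) with hs
  set T : ℝ := Q 0 0 0 0 + Q 0 1 0 0 + Q 1 0 0 0 + Q 1 1 0 0 with hT
  set A : Fin M → ℝ := fun x => Q 0 0 x 0 + Q 0 1 x 0 - Q 1 0 x 0 - Q 1 1 x 0 with hAd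
  set B : Fin M → ℝ := fun y => Q 0 0 0 y + Q 1 0 0 y - Q 0 1 0 y - Q 1 1 0 y with hBd
  have total x y : Q 0 0 x y + Q 0 1 x y + Q 1 0 x y + Q 1 1 x y = T := by
    linarith [hA 0 x 0 y, hA 1 x 0 y, hB 0 0 y 0, hB 1 0 y 0]
  have alice x y : Q 0 0 x y + Q 0 1 x y - Q 1 0 x y - Q 1 1 x y = A x := by
    simp only [hAd]; linarith [hB 0 x y 0, hB 1 x y 0]
  have bob x y : Q 0 0 x y + Q 1 0 x y - Q 0 1 x y - Q 1 1 x y = B y := by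
    simp only [hBd]; linarith [hA 0 x 0 y, hA 1 x 0 y]
  have key : ∑ a', ∑ b, ∑ x, ∑ y, βa M a a' b x y * Q a' b x y
      = ∑ x, ∑ y, ∑ a', ∑ b, βa M a a' b x y * Q a' b x y := by
    simp only [Fin.sum_univ_two, Finset.sum_add_distrib]
  have diag x : ∑ a', ∑ b, βa M a a' b x x * Q a' b x x
      = T / (4 * M) + s / 4 * ((if x = 0 then 1 else -1) * (A x - B x)) := by
    rw [← total x x, ← alice x x, ← bob x x]
    simp only [βa, νv_self, μv, Sprop, true_or, if_true, Fin.sum_univ_two, ← hs,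
      Fin.val_zero, Fin.val_one, pow_zero, pow_one]
    ring
  have offdiag x : ∑ a', ∑ b, βa M a a' b x (x + 1) * Q a' b x (x + 1)
      = T / (4 * M) + s / 4 * (A x + (if x + 1 = 0 then 1 else -1) * B (x + 1)) := by
    rw [← total x (x + 1), ← alice x (x + 1), ← bob x (x + 1)]
    simp only [βa, νv_succ hM, μv, Sprop, or_true, if_true, Fin.sum_univ_two, ← hs,
      Fin.val_zero, Fin.val_one, pow_zero, pow_one]
    ring
  have shift : ∑ x : Fin M, (if x + 1 = 0 then (1 : ℝ) else -1) * B (x + 1)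
      = ∑ y : Fin M, (if y = 0 then (1 : ℝ) else -1) * B y :=
    Equiv.sum_comp (Equiv.addRight (1 : Fin M)) fun y => (if y = 0 then (1 : ℝ) else -1) * B y
  have collapse : ∑ x : Fin M, ((if x = 0 then (1 : ℝ) else -1) * A x + A x) = 2 * A 0 := by
    rw [Finset.sum_eq_single (0 : Fin M)]
    · simp; ring
    · intro x _ hx; simp [hx]
    · simp
  have hM0 : (M : ℝ) ≠ 0 := Nat.cast_ne_zero.mpr (NeZero.ne M)
  have half : ∑ _x : Fin M, T / (4 * M) = T / 4 := by
    rw [Finset.sum_const, Finset.card_univ, Fintype.card_fin, nsmul_eq_mul]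
    field_simp
  have main : ∑ x, ∑ y, ∑ a', ∑ b, βa M a a' b x y * Q a' b x y = T / 2 + s / 2 * A 0 := by
    have hrow x := sum_mul_eq_diag_add_succ hM x
      (fun y => ∑ a', ∑ b, βa M a a' b x y * Q a' b x y)
      (fun y h h' => by simp [βa_eq_zero hM _ _ _ h h'])
    simp only [hrow, diag, offdiag]
    simp only [Finset.sum_add_distrib, ← Finset.mul_sum, mul_sub, Finset.sum_sub_distrib]
      at collapse ⊢
    rw [half, shift]
    linear_combination s / 4 * collapse
  rw [key, main, Fin.sum_univ_two, hB a 0 y₀ 0]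
  simp only [hs, hT, hAd]
  fin_cases a <;> simp <;> ring

theorem Fin.sum_univ_cons {α : Type*} [Fintype α] {n : ℕ} (F : (Fin (n + 1) → α) → ℝ) :
    ∑ f, F f = ∑ v, ∑ g : Fin n → α, F (Fin.cons v g) := by
  rw [← (Fin.consEquiv fun _ : Fin (n + 1) => α).sum_comp, Fintype.sum_prod_type]
  rfl

theorem sum_interleave {α β γ δ α' β' γ' δ' : Type*} [Fintype α] [Fintype β] [Fintype γ]
    [Fintype δ] [Fintype α'] [Fintype β'] [Fintype γ'] [Fintype δ']
    (F : α → β → γ → δ → α' → β' → γ' → δ' → ℝ) :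
    ∑ a, ∑ a', ∑ b, ∑ b', ∑ c, ∑ c', ∑ d, ∑ d', F a b c d a' b' c' d'
      = ∑ a, ∑ b, ∑ c, ∑ d, ∑ a', ∑ b', ∑ c', ∑ d', F a b c d a' b' c' d' := by
  refine Finset.sum_congr rfl fun a _ => ?_
  rw [Finset.sum_comm]
  refine Finset.sum_congr rfl fun b _ => ?_
  rw [Finset.sum_congr rfl fun a' _ => Finset.sum_comm, Finset.sum_comm]
  refine Finset.sum_congr rfl fun c _ => ?_
  rw [Finset.sum_congr rfl fun a' _ => Finset.sum_congr rfl fun b' _ => Finset.sum_comm,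
    Finset.sum_congr rfl fun a' _ => Finset.sum_comm, Finset.sum_comm]

/-- Contraction with `⊗ₙ β_{aₙ}` yields Alice's marginal at input `0` for every nonsignaling
array, without positivity or normalization. -/
theorem βa_tensor_contract_eq_marginal {M : ℕ} [NeZero M] (hM : 2 ≤ M) (N : ℕ)
    (P : (Fin N → Fin 2) → (Fin N → Fin 2) → (Fin N → Fin M) → (Fin N → Fin M) → ℝ)
    (nsA : ∀ (n : Fin N) (a b : Fin N → Fin 2) (x x' y : Fin N → Fin M),
      (∀ m, m ≠ n → x m = x' m) →
      ∑ v : Fin 2, P (Function.update a n v) b x y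
        = ∑ v : Fin 2, P (Function.update a n v) b x' y)
    (nsB : ∀ (n : Fin N) (a b : Fin N → Fin 2) (x y y' : Fin N → Fin M),
      (∀ m, m ≠ n → y m = y' m) →
      ∑ v : Fin 2, P a (Function.update b n v) x y
        = ∑ v : Fin 2, P a (Function.update b n v) x y')
    (a : Fin N → Fin 2) (y : Fin N → Fin M) :
    ∑ b, P a b (fun _ => 0) y
      = ∑ a' : Fin N → Fin 2, ∑ b : Fin N → Fin 2,
          ∑ x : Fin N → Fin M, ∑ y' : Fin N → Fin M,
            (∏ n, βa M (a n) (a' n) (b n) (x n) (y' n)) * P a' b x y' := by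
  induction N with
  | zero =>
    simp only [Fintype.sum_unique, Finset.univ_eq_empty, Finset.prod_empty, one_mul]
    congr 1 <;> exact Subsingleton.elim _ _
  | succ N ih =>
    have tail_agree {u v : Fin M} (w : Fin N → Fin M) (m : Fin (N + 1)) (hm : m ≠ 0) :
        (Fin.cons u w : Fin (N + 1) → Fin M) m = (Fin.cons v w : Fin (N + 1) → Fin M) m := by
      obtain ⟨k, rfl⟩ := Fin.exists_succ_eq.mpr hm
      simp
    have cons_agree {n : Fin N} (u : Fin M) {w w' : Fin N → Fin M}
        (h : ∀ m, m ≠ n → w m = w' m) (m : Fin (N + 1)) (hm : m ≠ n.succ) :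
        (Fin.cons u w : Fin (N + 1) → Fin M) m = (Fin.cons u w' : Fin (N + 1) → Fin M) m := by
      refine Fin.cases (fun _ => rfl) (fun k hk => ?_) m hm
      simpa using h k fun e => hk (by rw [e])
    have rest (a₀ b₀ : Fin 2) (x₀ y₀ : Fin M) :=
      ih (fun a b x y => P (Fin.cons a₀ a) (Fin.cons b₀ b) (Fin.cons x₀ x) (Fin.cons y₀ y))
        (fun n a b x x' y h => by
          simpa only [Fin.cons_update] using
            nsA n.succ (Fin.cons a₀ a) (Fin.cons b₀ b) _ _ (Fin.cons y₀ y) (cons_agree x₀ h))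
        (fun n a b x y y' h => by
          simpa only [Fin.cons_update] using
            nsB n.succ (Fin.cons a₀ a) (Fin.cons b₀ b) (Fin.cons x₀ x) _ _ (cons_agree y₀ h))
        (Fin.tail a) (Fin.tail y)
    have first := βa_contract_eq_marginal hM
      (fun a₀ b₀ x₀ y₀ => ∑ b, P (Fin.cons a₀ (Fin.tail a)) (Fin.cons b₀ b)
        (Fin.cons x₀ fun _ => 0) (Fin.cons y₀ (Fin.tail y)))
      (fun b₀ x x' y₀ => by
        rw [Finset.sum_comm, Finset.sum_comm (s := Finset.univ (α := Fin 2))]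
        refine Finset.sum_congr rfl fun b _ => ?_
        simpa only [Fin.update_cons_zero] using
          nsA 0 (Fin.cons 0 (Fin.tail a)) (Fin.cons b₀ b) (Fin.cons x fun _ => 0)
            (Fin.cons x' fun _ => 0) (Fin.cons y₀ (Fin.tail y)) (tail_agree _))
      (fun a₀ x₀ y₀ y₀' => by
        rw [Finset.sum_comm, Finset.sum_comm (s := Finset.univ (α := Fin 2))]
        refine Finset.sum_congr rfl fun b _ => ?_
        simpa only [Fin.update_cons_zero] using
          nsB 0 (Fin.cons a₀ (Fin.tail a)) (Fin.cons 0 b) (Fin.cons x₀ fun _ => 0)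
            (Fin.cons y₀ (Fin.tail y)) (Fin.cons y₀' (Fin.tail y)) (tail_agree _))
      (a 0) (y 0)
    have zero_eq : (Fin.cons 0 fun _ => 0 : Fin (N + 1) → Fin M) = fun _ => 0 := by
      funext m; refine Fin.cases rfl (fun _ => rfl) m
    simp only [Fin.cons_self_tail, zero_eq] at first
    simp only [Fin.sum_univ_cons]
    rw [sum_interleave (fun a₀ b₀ x₀ y₀ a' b x y' => _), ← first]
    refine Finset.sum_congr rfl fun a₀ _ => Finset.sum_congr rfl fun b₀ _ =>
      Finset.sum_congr rfl fun x₀ _ => Finset.sum_congr rfl fun y₀ _ => ?_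
    rw [rest]
    simp only [Fin.prod_univ_succ, Fin.cons_zero, Fin.cons_succ, Finset.mul_sum, mul_assoc,
      Fin.tail]

/-- Lemma 5 of the paper: for any `2N`-partite nonsignaling conditional distribution
`P(𝐚,𝐛|𝐱,𝐲)`, Alice's marginal with all her inputs set to `0` equals the dot product
`(β_{a₁} ⊗ ⋯ ⊗ β_{a_N}) · P`. -/
theorem alice_marginal_eq_beta_tensor_dot
    (M N : ℕ) [NeZero M] (hM : 2 ≤ M) (hN : 1 ≤ N)
    (P : (Fin N → Fin 2) → (Fin N → Fin 2) → (Fin N → Fin M) → (Fin N → Fin M) → ℝ)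
    (hpos : ∀ a b x y, 0 ≤ P a b x y)
    (hnorm : ∀ x y, ∑ a, ∑ b, P a b x y = 1)
    (nsA : ∀ (n : Fin N) (a b : Fin N → Fin 2) (x x' y : Fin N → Fin M),
      (∀ m, m ≠ n → x m = x' m) →
      ∑ v : Fin 2, P (Function.update a n v) b x y
        = ∑ v : Fin 2, P (Function.update a n v) b x' y)
    (nsB : ∀ (n : Fin N) (a b : Fin N → Fin 2) (x y y' : Fin N → Fin M),
      (∀ m, m ≠ n → y m = y' m) →
      ∑ v : Fin 2, P a (Function.update b n v) x y
        = ∑ v : Fin 2, P a (Function.update b n v) x y') :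
    ∀ (a : Fin N → Fin 2) (y : Fin N → Fin M),
      ∑ b, P a b (fun _ => 0) y
        = ∑ a' : Fin N → Fin 2, ∑ b : Fin N → Fin 2,
            ∑ x : Fin N → Fin M, ∑ y' : Fin N → Fin M,
              (∏ n, βa M (a n) (a' n) (b n) (x n) (y' n)) * P a' b x y' := by
  exact βa_tensor_contract_eq_marginal hM N P nsA nsB
end

section
/- Every local bipartite distribution satisfies the Braunstein–Caves inequality: if P(a,b|x,y) = Σ_{v ∈ V} P_V(v)·P_A(a|x,v)·P_B(b|y,v) for some finite set V, probability distribution P_V, and conditional distributions P_A, P_B (with outputs a,b ∈ {0,1} and inputs x,y ∈ {0,…,M−1}), then ⟨ℬ⟩ = Σ_{(x,y) ∈ S} (1/(2M)) Σ_{a,b} ℬ(a,b,x,y) P(a,b|x,y) ≥ 1. -/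
open scoped Classical
open Finset

set_option linter.unusedVariables false

/-- The Braunstein–Caves random variable `ℬ(a,b,x,y) = 1/2 + M·(a ⊕ b ⊕ [x=M-1][y=0])`. -/
noncomputable def BC (M : ℕ) [NeZero M] (a b : Fin 2) (x y : Fin M) : ℝ :=
  1 / 2 + M * ((((a : ℕ) + (b : ℕ) +
    (if (x : ℕ) = M - 1 ∧ (y : ℕ) = 0 then 1 else 0)) % 2 : ℕ) : ℝ)

/-- Probability that two independent bits, equal to `1` with probabilities `p` and `q`, differ. -/
def diffProb (p q : ℝ) : ℝ := p + q - 2 * p * q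

lemma diffProb_comm (p q : ℝ) : diffProb p q = diffProb q p := by
  unfold diffProb; ring

lemma diffProb_triangle {p q r : ℝ} (hp : p ∈ Set.Icc (0 : ℝ) 1) (hq : q ∈ Set.Icc (0 : ℝ) 1)
    (hr : r ∈ Set.Icc (0 : ℝ) 1) : diffProb p r ≤ diffProb p q + diffProb q r := by
  have h1 : 0 ≤ q * (1 - p) * (1 - r) :=
    mul_nonneg (mul_nonneg hq.1 (sub_nonneg.2 hp.2)) (sub_nonneg.2 hr.2)
  have h2 : 0 ≤ (1 - q) * p * r :=
    mul_nonneg (mul_nonneg (sub_nonneg.2 hq.2) hp.1) hr.1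
  unfold diffProb
  linarith

lemma diffProb_chain (n : ℕ) (α β : Fin (n + 1) → ℝ) (hα : ∀ i, α i ∈ Set.Icc (0 : ℝ) 1)
    (hβ : ∀ i, β i ∈ Set.Icc (0 : ℝ) 1) :
    diffProb (α (Fin.last n)) (β 0) ≤
      ∑ i, diffProb (α i) (β i) + ∑ i : Fin n, diffProb (α i.castSucc) (β i.succ) := by
  induction n with
  | zero => simp
  | succ n ih =>
    have h := ih (fun i => α i.castSucc) (fun i => β i.castSucc) (fun i => hα _) fun i => hβ _
    rw [Fin.sum_univ_castSucc (fun i => diffProb (α i) (β i)),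
      Fin.sum_univ_castSucc (fun i : Fin (n + 1) => diffProb (α i.castSucc) (β i.succ))]
    have h1 := diffProb_triangle (hα (Fin.last (n + 1))) (hβ (Fin.last (n + 1))) (hβ 0)
    have h2 := diffProb_triangle (hβ (Fin.last (n + 1))) (hα (Fin.last n).castSucc) (hβ 0)
    rw [diffProb_comm (β _) (α _)] at h2
    simp only [Fin.castSucc_zero, Fin.succ_castSucc, Fin.succ_last] at *
    linarith

/-- Probability that `a ⊕ b ⊕ [x = M-1][y = 0]` equals `1` for independent bits `a`, `b`. -/
noncomputable def winProb {M : ℕ} (α β : Fin M → ℝ) (x y : Fin M) : ℝ :=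
  if (x : ℕ) = M - 1 ∧ (y : ℕ) = 0 then 1 - diffProb (α x) (β y) else diffProb (α x) (β y)

lemma one_le_sum_winProb (n : ℕ) (hn : n ≠ 0) (α β : Fin (n + 1) → ℝ)
    (hα : ∀ i, α i ∈ Set.Icc (0 : ℝ) 1) (hβ : ∀ i, β i ∈ Set.Icc (0 : ℝ) 1) :
    1 ≤ ∑ x, (winProb α β x x + winProb α β x (x + 1)) := by
  have h := diffProb_chain n α β hα hβ
  have h1 : ∀ x, winProb α β x x = diffProb (α x) (β x) := fun x =>
    if_neg (by omega)
  have h2 : ∀ i : Fin n, winProb α β i.castSucc (i.castSucc + 1)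
      = diffProb (α i.castSucc) (β i.succ) := fun i => by
    rw [Fin.coeSucc_eq_succ]
    exact if_neg (by simp)
  have h3 : winProb α β (Fin.last n) (Fin.last n + 1)
      = 1 - diffProb (α (Fin.last n)) (β 0) := by
    rw [Fin.last_add_one]
    exact if_pos (by simp)
  rw [sum_add_distrib, Fin.sum_univ_castSucc (fun x => winProb α β x (x + 1))]
  simp only [h1, h2, h3]
  linarith

lemma sum_Sprop {M : ℕ} [NeZero M] (hM : 2 ≤ M) (F : Fin M → Fin M → ℝ) (x : Fin M) :
    ∑ y, (if Sprop x y then F x y else 0) = F x x + F x (x + 1) := by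
  obtain ⟨n, rfl⟩ : ∃ n, M = n + 2 := ⟨M - 2, by omega⟩
  have hx : x ≠ x + 1 := by simp
  rw [← sum_filter, ← sum_pair hx]
  refine sum_congr ?_ fun _ _ => rfl
  ext y
  rw [mem_filter]
  simp [Sprop]

lemma sum_BC_mul {M : ℕ} [NeZero M] (x y : Fin M) (α β : Fin M → ℝ) (p q : Fin 2 → ℝ)
    (hp : ∑ a, p a = 1) (hq : ∑ b, q b = 1) (hα : α x = p 1) (hβ : β y = q 1) :
    ∑ a, ∑ b, BC M a b x y * (p a * q b) = 1 / 2 + M * winProb α β x y := by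
  rw [Fin.sum_univ_two] at hp hq
  have hp' : p 0 = 1 - p 1 := by linarith
  have hq' : q 0 = 1 - q 1 := by linarith
  simp only [Fin.sum_univ_two, BC, winProb, diffProb, hα, hβ, hp', hq']
  split_ifs <;> norm_num <;> ring

/-- Every local bipartite distribution satisfies the Braunstein–Caves inequality
`⟨ℬ⟩ ≥ 1`. -/
theorem local_satisfies_BC
    (M : ℕ) [NeZero M] (hM : 2 ≤ M)
    {V : Type} [Fintype V]
    (pV : V → ℝ) (hpV0 : ∀ v, 0 ≤ pV v) (hpV1 : ∑ v, pV v = 1)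
    (pA : Fin 2 → Fin M → V → ℝ)
    (hpA0 : ∀ a x v, 0 ≤ pA a x v) (hpA1 : ∀ x v, ∑ a, pA a x v = 1)
    (pB : Fin 2 → Fin M → V → ℝ)
    (hpB0 : ∀ b y v, 0 ≤ pB b y v) (hpB1 : ∀ y v, ∑ b, pB b y v = 1) :
    1 ≤ ∑ x : Fin M, ∑ y : Fin M,
        (if Sprop x y then
            (1 / (2 * (M : ℝ))) *
              ∑ a, ∑ b, BC M a b x y * ∑ v, pV v * pA a x v * pB b y v
          else 0) := by
  have hM0 : (M : ℝ) ≠ 0 := NeZero.ne _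
  have key : ∀ x y, (1 / (2 * (M : ℝ))) *
      ∑ a, ∑ b, BC M a b x y * ∑ v, pV v * pA a x v * pB b y v =
      ∑ v, pV v * (1 / (4 * M) + winProb (fun x => pA 1 x v) (fun y => pB 1 y v) x y / 2) := by
    intro x y
    have h : ∑ a, ∑ b, BC M a b x y * ∑ v, pV v * pA a x v * pB b y v =
        ∑ v, pV v * ∑ a, ∑ b, BC M a b x y * (pA a x v * pB b y v) := by
      simp only [Fin.sum_univ_two, mul_sum, ← sum_add_distrib]
      exact sum_congr rfl fun v _ => by ring
    rw [h, mul_sum]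
    refine sum_congr rfl fun v _ => ?_
    rw [sum_BC_mul x y (fun x => pA 1 x v) (fun y => pB 1 y v) (fun a => pA a x v)
      (fun b => pB b y v) (hpA1 x v) (hpB1 y v) rfl rfl]
    field_simp
    ring
  simp only [key]
  simp only [sum_Sprop hM (fun x y => ∑ v, pV v *
    (1 / (4 * M) + winProb (fun x => pA 1 x v) (fun y => pB 1 y v) x y / 2)),
    ← sum_add_distrib]
  rw [sum_comm]
  refine hpV1.symm.trans_le (sum_le_sum fun v _ => ?_)
  have hA : ∀ x, pA 1 x v ∈ Set.Icc (0 : ℝ) 1 := fun x => ⟨hpA0 1 x v, by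
    have := hpA1 x v; rw [Fin.sum_univ_two] at this; linarith [hpA0 0 x v]⟩
  have hB : ∀ y, pB 1 y v ∈ Set.Icc (0 : ℝ) 1 := fun y => ⟨hpB0 1 y v, by
    have := hpB1 y v; rw [Fin.sum_univ_two] at this; linarith [hpB0 0 y v]⟩
  have hG : 1 ≤ ∑ x, (winProb (fun x => pA 1 x v) (fun y => pB 1 y v) x x +
      winProb (fun x => pA 1 x v) (fun y => pB 1 y v) x (x + 1)) := by
    obtain ⟨n, rfl⟩ : ∃ n, M = n + 1 := ⟨M - 1, by omega⟩
    exact one_le_sum_winProb n (by omega) _ _ hA hB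
  have hsum : ∑ x, (pV v * (1 / (4 * M) +
        winProb (fun x => pA 1 x v) (fun y => pB 1 y v) x x / 2) +
      pV v * (1 / (4 * M) + winProb (fun x => pA 1 x v) (fun y => pB 1 y v) x (x + 1) / 2)) =
      pV v * (1 / 2 + (∑ x, (winProb (fun x => pA 1 x v) (fun y => pB 1 y v) x x +
      winProb (fun x => pA 1 x v) (fun y => pB 1 y v) x (x + 1))) / 2) := by
    have hc : (1 / 2 : ℝ) = ∑ _x : Fin M, 1 / (2 * (M : ℝ)) := by
      rw [sum_const, card_univ, Fintype.card_fin, nsmul_eq_mul]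
      field_simp
    rw [hc, sum_div, ← sum_add_distrib, mul_sum]
    refine sum_congr rfl fun x _ => ?_
    field_simp
    ring
  rw [hsum]
  exact le_mul_of_one_le_right (hpV0 v) (by linarith)
end
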